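/- arXiv:patt-sol/9701011 — 3 statements merged into one kernel-verified Lean document; each statement's English description precedes it below -/
import Mathlib

section
/- Viewing $\Lambda_4$ and $\Lambda_6$ as functions of $\omega$ (with $\alpha$ fixed, $\alpha \ne 0$), the ratio $\Lambda_{d_2}(\omega) = \Lambda_6(\omega)/\Lambda_4(\omega)$ is differentiable and strictly increasing: $\frac{d}{d\omega}\Lambda_{d_2}(\omega) > 0$ for all $\omega$ with $0 < \beta(\omega) < 1$. Consequently $\frac{d\Lambda_{d_2}/d\omega}{d\Lambda_{24}/d\omega} < 0$, where $\Lambda_{24}(\omega) = \Lambda_2(\omega)/\Lambda_4(\omega)$. -/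
open MeasureTheory

open Filter Topology

lemma integral_eq_two_mul_of_odd_primitive {f G : ℝ → ℝ} {l : ℝ}
    (hG : ∀ x, HasDerivAt G (f x) x) (hf : Integrable f) (hodd : ∀ x, G (-x) = -G x)
    (hbot : Tendsto G atBot (𝓝 (-l))) : ∫ x, f x = 2 * l := by
  have htop : Tendsto G atTop (𝓝 l) := by
    have h := (hbot.comp tendsto_neg_atTop_atBot).neg
    simpa [Function.comp_def, hodd] using h
  rw [integral_of_hasDerivAt_of_tendsto hG hf hbot htop]
  ring

lemma one_add_sq_div_two_le_cosh (x : ℝ) : 1 + x ^ 2 / 2 ≤ Real.cosh x := by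
  have h1 : (x / 2) ^ 2 ≤ Real.sinh (x / 2) ^ 2 := by
    rw [sq_le_sq, Real.abs_sinh]
    exact Real.self_le_sinh_iff.2 (abs_nonneg _)
  have h2 := Real.cosh_two_mul (x / 2)
  rw [mul_div_cancel₀ x two_ne_zero, Real.cosh_sq] at h2
  nlinarith

section CoshIntegrals

variable {c : ℝ}

lemma integrable_inv_add_cosh_pow (hc : 1 ≤ c) (n : ℕ) :
    Integrable fun x : ℝ => ((c + Real.cosh x) ^ (n + 1))⁻¹ := by
  have hpos : ∀ x : ℝ, 0 < c + Real.cosh x := fun x => by linarith [Real.cosh_pos x]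
  refine (integrable_inv_one_add_sq.const_mul 2).mono'
    (Continuous.aestronglyMeasurable ?_) (ae_of_all _ fun x => ?_)
  · exact ((continuous_const.add Real.continuous_cosh).pow _).inv₀ fun x => (pow_pos (hpos x) _).ne'
  · have h1 : (1 : ℝ) ≤ c + Real.cosh x := by linarith [Real.cosh_pos x]
    have h2 : c + Real.cosh x ≤ (c + Real.cosh x) ^ (n + 1) := le_self_pow₀ h1 n.succ_ne_zero
    rw [Real.norm_of_nonneg (inv_nonneg.2 (pow_pos (hpos x) _).le), ← div_eq_mul_inv,
      inv_eq_one_div, div_le_div_iff₀ (pow_pos (hpos x) _) (by positivity)]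
    linarith [one_add_sq_div_two_le_cosh x]

lemma hasDerivAt_sinh_div_add_cosh (hc : 1 ≤ c) (x : ℝ) :
    HasDerivAt (fun x => Real.sinh x / (c + Real.cosh x))
      (c * ((c + Real.cosh x) ^ 1)⁻¹ - (c ^ 2 - 1) * ((c + Real.cosh x) ^ 2)⁻¹) x := by
  have hpos : 0 < c + Real.cosh x := by linarith [Real.cosh_pos x]
  refine ((Real.hasDerivAt_sinh x).fun_div ((Real.hasDerivAt_cosh x).const_add c)
    hpos.ne').congr_deriv ?_
  have := Real.cosh_sq x
  field_simp
  linear_combination this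

lemma hasDerivAt_sinh_div_add_cosh_sq (hc : 1 ≤ c) (x : ℝ) :
    HasDerivAt (fun x => Real.sinh x / (c + Real.cosh x) ^ 2)
      (3 * c * ((c + Real.cosh x) ^ 2)⁻¹ - ((c + Real.cosh x) ^ 1)⁻¹
        - 2 * (c ^ 2 - 1) * ((c + Real.cosh x) ^ 3)⁻¹) x := by
  have hpos : 0 < c + Real.cosh x := by linarith [Real.cosh_pos x]
  refine ((Real.hasDerivAt_sinh x).fun_div (((Real.hasDerivAt_cosh x).const_add c).fun_pow 2)
    (pow_pos hpos 2).ne').congr_deriv ?_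
  have := Real.cosh_sq x
  push_cast
  field_simp
  linear_combination 2 * this

lemma tendsto_sinh_div_add_cosh_atBot (hc : 1 ≤ c) :
    Tendsto (fun x => Real.sinh x / (c + Real.cosh x)) atBot (𝓝 (-1)) := by
  have hcont : ContinuousAt (fun y : ℝ => (y ^ 2 - 1) / (2 * c * y + y ^ 2 + 1)) 0 := by
    fun_prop (disch := norm_num)
  have h := hcont.tendsto.comp Real.tendsto_exp_atBot
  norm_num at h
  refine h.congr fun x => ?_
  have hx := Real.exp_pos x
  simp only [Function.comp, Real.sinh_eq, Real.cosh_eq, Real.exp_neg]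
  field_simp
  ring

lemma tendsto_sinh_div_add_cosh_sq_atBot (hc : 1 ≤ c) :
    Tendsto (fun x => Real.sinh x / (c + Real.cosh x) ^ 2) atBot (𝓝 (-0)) := by
  have hcont : ContinuousAt
      (fun y : ℝ => 2 * y * (y ^ 2 - 1) / (2 * c * y + y ^ 2 + 1) ^ 2) 0 := by
    fun_prop (disch := norm_num)
  have h := hcont.tendsto.comp Real.tendsto_exp_atBot
  norm_num at h
  rw [neg_zero]
  refine h.congr fun x => ?_
  have hx := Real.exp_pos x
  simp only [Function.comp, Real.sinh_eq, Real.cosh_eq, Real.exp_neg]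
  field_simp
  ring

lemma integral_inv_add_cosh_sq_relation (hc : 1 ≤ c) :
    c * (∫ x : ℝ, ((c + Real.cosh x) ^ 1)⁻¹)
      - (c ^ 2 - 1) * (∫ x : ℝ, ((c + Real.cosh x) ^ 2)⁻¹) = 2 := by
  have h1 := integrable_inv_add_cosh_pow hc 0
  have h2 := integrable_inv_add_cosh_pow hc 1
  have h := integral_eq_two_mul_of_odd_primitive (hasDerivAt_sinh_div_add_cosh hc)
    ((h1.const_mul c).sub (h2.const_mul (c ^ 2 - 1))) (fun x => by simp [neg_div])
    (tendsto_sinh_div_add_cosh_atBot hc)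
  rw [integral_sub (h1.const_mul c) (h2.const_mul _), integral_const_mul, integral_const_mul] at h
  simpa using h

lemma integral_inv_add_cosh_cube_relation (hc : 1 ≤ c) :
    3 * c * (∫ x : ℝ, ((c + Real.cosh x) ^ 2)⁻¹) - (∫ x : ℝ, ((c + Real.cosh x) ^ 1)⁻¹)
      - 2 * (c ^ 2 - 1) * (∫ x : ℝ, ((c + Real.cosh x) ^ 3)⁻¹) = 0 := by
  have h1 := integrable_inv_add_cosh_pow hc 0
  have h2 := integrable_inv_add_cosh_pow hc 1
  have h3 := integrable_inv_add_cosh_pow hc 2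
  have h := integral_eq_two_mul_of_odd_primitive (hasDerivAt_sinh_div_add_cosh_sq hc)
    (((h2.const_mul (3 * c)).sub h1).sub (h3.const_mul (2 * (c ^ 2 - 1))))
    (fun x => by simp [neg_div]) (tendsto_sinh_div_add_cosh_sq_atBot hc)
  have h21 : Integrable fun x : ℝ =>
      3 * c * ((c + Real.cosh x) ^ 2)⁻¹ - ((c + Real.cosh x) ^ 1)⁻¹ := (h2.const_mul (3 * c)).sub h1
  rw [integral_sub h21 (h3.const_mul _), integral_sub (h2.const_mul _) h1, integral_const_mul,
    integral_const_mul] at h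
  simpa using h

end CoshIntegrals

section ClosedForms

variable {θ : ℝ}

lemma sinh_mul_integral_inv_cosh_add_cosh (θ : ℝ) :
    Real.sinh θ * (∫ x : ℝ, ((Real.cosh θ + Real.cosh x) ^ 1)⁻¹) = 2 * θ := by
  have hd : ∀ x : ℝ, HasDerivAt
      (fun x => Real.log (Real.exp θ * Real.exp x + 1) - Real.log (Real.exp x + Real.exp θ))
      (Real.sinh θ * ((Real.cosh θ + Real.cosh x) ^ 1)⁻¹) x := by
    intro x
    have hx := Real.exp_pos x
    have hθ := Real.exp_pos θ
    have h1 : HasDerivAt (fun x => Real.exp θ * Real.exp x + 1) (Real.exp θ * Real.exp x) x :=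
      ((Real.hasDerivAt_exp x).const_mul _).add_const _
    have h2 : HasDerivAt (fun x => Real.exp x + Real.exp θ) (Real.exp x) x :=
      (Real.hasDerivAt_exp x).add_const _
    refine ((h1.log (by positivity)).fun_sub (h2.log (by positivity))).congr_deriv ?_
    simp only [Real.sinh_eq, Real.cosh_eq, Real.exp_neg]
    have h3 : (Real.exp θ + (Real.exp θ)⁻¹) / 2 + (Real.exp x + (Real.exp x)⁻¹) / 2
        = (Real.exp θ * Real.exp x + 1) * (Real.exp x + Real.exp θ)
          / (2 * (Real.exp θ * Real.exp x)) := by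
      field_simp
      ring
    rw [h3]
    field_simp
    ring
  rw [← integral_const_mul]
  refine integral_eq_two_mul_of_odd_primitive hd
    ((integrable_inv_add_cosh_pow (Real.one_le_cosh θ) 0).const_mul _) (fun x => ?_) ?_
  · have hx := Real.exp_pos x
    have hθ := Real.exp_pos θ
    have h1 : Real.exp θ * Real.exp (-x) + 1 = (Real.exp x + Real.exp θ) / Real.exp x := by
      rw [Real.exp_neg]; field_simp; ring
    have h2 : Real.exp (-x) + Real.exp θ = (Real.exp θ * Real.exp x + 1) / Real.exp x := by
      rw [Real.exp_neg]; field_simp; ring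
    rw [h1, h2, Real.log_div (by positivity) hx.ne', Real.log_div (by positivity) hx.ne']
    ring
  · have hθ := Real.exp_pos θ
    have hcont : ContinuousAt
        (fun y : ℝ => Real.log (Real.exp θ * y + 1) - Real.log (y + Real.exp θ)) 0 := by
      fun_prop (disch := simp)
    simpa [Function.comp_def] using hcont.tendsto.comp Real.tendsto_exp_atBot

lemma sinh_lt_self_mul_cosh (hθ : 0 < θ) : Real.sinh θ < θ * Real.cosh θ := by
  have hmono : StrictMonoOn (fun t => t * Real.cosh t - Real.sinh t) (Set.Ici 0) := by
    refine strictMonoOn_of_hasDerivWithinAt_pos (f' := fun t => t * Real.sinh t)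
      (convex_Ici 0) (by fun_prop) (fun t _ => ?_) (fun t ht => ?_)
    · refine HasDerivAt.hasDerivWithinAt ?_
      refine (((hasDerivAt_id' t).fun_mul (Real.hasDerivAt_cosh t)).fun_sub
        (Real.hasDerivAt_sinh t)).congr_deriv ?_
      ring
    · rw [interior_Ici] at ht
      exact mul_pos ht (Real.sinh_pos_iff.2 ht)
  have h := hmono Set.self_mem_Ici hθ.le hθ
  simp at h
  exact h

lemma three_mul_self_mul_cosh_le (hθ : 0 < θ) :
    3 * θ * Real.cosh θ ≤ (3 + θ ^ 2) * Real.sinh θ := by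
  have hmono : MonotoneOn (fun t => (3 + t ^ 2) * Real.sinh t - 3 * t * Real.cosh t)
      (Set.Ici 0) := by
    refine monotoneOn_of_hasDerivWithinAt_nonneg
      (f' := fun t => t * (t * Real.cosh t - Real.sinh t))
      (convex_Ici 0) (by fun_prop) (fun t _ => ?_) (fun t ht => ?_)
    · refine HasDerivAt.hasDerivWithinAt ?_
      refine (((((hasDerivAt_id' t).fun_pow 2).const_add 3).fun_mul (Real.hasDerivAt_sinh t)).fun_sub
        (((hasDerivAt_id' t).const_mul 3).fun_mul (Real.hasDerivAt_cosh t))).congr_deriv ?_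
      push_cast
      ring
    · rw [interior_Ici] at ht
      exact mul_nonneg (le_of_lt ht) (sub_nonneg.2 (sinh_lt_self_mul_cosh ht).le)
  have h := hmono Set.self_mem_Ici hθ.le hθ.le
  simp at h
  exact h

lemma sq_add_pow_four_div_three_le_sinh_sq (hθ : 0 < θ) :
    θ ^ 2 + θ ^ 4 / 3 ≤ Real.sinh θ ^ 2 := by
  have hmono : MonotoneOn (fun t => Real.sinh t - t - t ^ 3 / 6) (Set.Ici 0) := by
    refine monotoneOn_of_hasDerivWithinAt_nonneg
      (f' := fun t => Real.cosh t - 1 - t ^ 2 / 2)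
      (convex_Ici 0) (by fun_prop) (fun t _ => ?_) (fun t ht => ?_)
    · refine HasDerivAt.hasDerivWithinAt ?_
      refine (((Real.hasDerivAt_sinh t).fun_sub (hasDerivAt_id' t)).fun_sub
        (((hasDerivAt_id' t).fun_pow 3).div_const 6)).congr_deriv ?_
      push_cast
      ring
    · linarith [one_add_sq_div_two_le_cosh t]
  have h := hmono Set.self_mem_Ici hθ.le hθ.le
  simp at h
  have h2 : θ + θ ^ 3 / 6 ≤ Real.sinh θ := by linarith
  have h3 := pow_le_pow_left₀ (by positivity) h2 2
  have h4 : 0 ≤ θ ^ 6 := by positivity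
  nlinarith

lemma two_mul_sq_mul_cosh_lt (hθ : 0 < θ) :
    2 * θ ^ 2 * Real.cosh θ < θ * Real.sinh θ + Real.cosh θ * Real.sinh θ ^ 2 := by
  have h1 := mul_le_mul_of_nonneg_left (three_mul_self_mul_cosh_le hθ) hθ.le
  have h2 := mul_le_mul_of_nonneg_left (sq_add_pow_four_div_three_le_sinh_sq hθ)
    (mul_nonneg (by positivity) (Real.cosh_pos θ).le : 0 ≤ (3 + θ ^ 2) * Real.cosh θ)
  have h3 : 0 < θ ^ 6 * Real.cosh θ := mul_pos (by positivity) (Real.cosh_pos θ)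
  refine lt_of_mul_lt_mul_left (a := 3 + θ ^ 2) ?_ (by positivity)
  nlinarith

lemma self_lt_cosh_mul_sinh (hθ : 0 < θ) : θ < Real.cosh θ * Real.sinh θ :=
  (Real.self_lt_sinh_iff.2 hθ).trans
    (lt_mul_of_one_lt_left (Real.sinh_pos_iff.2 hθ) (Real.one_lt_cosh.2 hθ.ne'))

lemma exists_pos_hasDerivAt_sixth_moment_ratio (hθ : 0 < θ) :
    ∃ d, 0 < d ∧ HasDerivAt (fun t => 3 - t * Real.sinh t ^ 2 /
      (Real.cosh t * (t * Real.cosh t - Real.sinh t))) d θ := by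
  have hs := Real.sinh_pos_iff.2 hθ
  have hc := Real.cosh_pos θ
  have hD : 0 < Real.cosh θ * (θ * Real.cosh θ - Real.sinh θ) :=
    mul_pos hc (sub_pos.2 (sinh_lt_self_mul_cosh hθ))
  refine ⟨Real.sinh θ * (θ * Real.sinh θ + Real.cosh θ * Real.sinh θ ^ 2
      - 2 * θ ^ 2 * Real.cosh θ) / (Real.cosh θ * (θ * Real.cosh θ - Real.sinh θ)) ^ 2,
    div_pos (mul_pos hs (sub_pos.2 (two_mul_sq_mul_cosh_lt hθ))) (pow_pos hD 2), ?_⟩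
  refine ((((hasDerivAt_id' θ).fun_mul ((Real.hasDerivAt_sinh θ).fun_pow 2)).fun_div
    ((Real.hasDerivAt_cosh θ).fun_mul (((hasDerivAt_id' θ).fun_mul
      (Real.hasDerivAt_cosh θ)).fun_sub (Real.hasDerivAt_sinh θ))) hD.ne').const_sub 3).congr_deriv ?_
  rw [← neg_div]
  congr 1
  push_cast
  have h := Real.cosh_sq θ
  linear_combination (-2 * θ ^ 2 * Real.sinh θ * Real.cosh θ + θ * Real.sinh θ ^ 2) * h

lemma exists_neg_hasDerivAt_second_moment_ratio (hθ : 0 < θ) :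
    ∃ d, d < 0 ∧ HasDerivAt
      (fun t => t * Real.cosh t / (t * Real.cosh t - Real.sinh t)) d θ := by
  have hD : 0 < θ * Real.cosh θ - Real.sinh θ := sub_pos.2 (sinh_lt_self_mul_cosh hθ)
  refine ⟨(θ - Real.cosh θ * Real.sinh θ) / (θ * Real.cosh θ - Real.sinh θ) ^ 2,
    div_neg_of_neg_of_pos (sub_neg.2 (self_lt_cosh_mul_sinh hθ)) (pow_pos hD 2), ?_⟩
  have h1 := (hasDerivAt_id' θ).fun_mul (Real.hasDerivAt_cosh θ)
  refine (h1.fun_div (h1.fun_sub (Real.hasDerivAt_sinh θ)) hD.ne').congr_deriv ?_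
  congr 1
  linear_combination θ * Real.cosh_sq θ

lemma integral_inv_cosh_add_cosh (hθ : 0 < θ) :
    ∫ x : ℝ, ((Real.cosh θ + Real.cosh x) ^ 1)⁻¹ = 2 * θ / Real.sinh θ := by
  rw [eq_div_iff (Real.sinh_pos_iff.2 hθ).ne', mul_comm]
  exact sinh_mul_integral_inv_cosh_add_cosh θ

lemma integral_inv_cosh_add_cosh_sq (hθ : 0 < θ) :
    ∫ x : ℝ, ((Real.cosh θ + Real.cosh x) ^ 2)⁻¹
      = 2 * (θ * Real.cosh θ - Real.sinh θ) / Real.sinh θ ^ 3 := by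
  have hs := Real.sinh_pos_iff.2 hθ
  have h := integral_inv_add_cosh_sq_relation (Real.one_le_cosh θ)
  rw [integral_inv_cosh_add_cosh hθ, Real.cosh_sq, add_sub_cancel_right] at h
  rw [eq_div_iff (pow_pos hs 3).ne']
  generalize (∫ x : ℝ, ((Real.cosh θ + Real.cosh x) ^ 2)⁻¹) = I at h ⊢
  field_simp at h
  linear_combination -h

lemma integral_inv_cosh_add_cosh_cube (hθ : 0 < θ) :
    ∫ x : ℝ, ((Real.cosh θ + Real.cosh x) ^ 3)⁻¹
      = (3 * Real.cosh θ * (θ * Real.cosh θ - Real.sinh θ) - θ * Real.sinh θ ^ 2)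
        / Real.sinh θ ^ 5 := by
  have hs := Real.sinh_pos_iff.2 hθ
  have h := integral_inv_add_cosh_cube_relation (Real.one_le_cosh θ)
  rw [integral_inv_cosh_add_cosh hθ, integral_inv_cosh_add_cosh_sq hθ, Real.cosh_sq,
    add_sub_cancel_right] at h
  rw [eq_div_iff (pow_pos hs 5).ne']
  generalize (∫ x : ℝ, ((Real.cosh θ + Real.cosh x) ^ 3)⁻¹) = I at h ⊢
  field_simp at h
  linear_combination -h / 2

end ClosedForms

lemma exists_pos_hasDerivAt_artanh_sqrt {a ω : ℝ} (h0 : 0 < a) (hω : 0 < ω) (h1 : a * ω < 1) :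
    ∃ d, 0 < d ∧ HasDerivAt (fun w => Real.artanh (√(a * w))) d ω := by
  have hpos : 0 < a * ω := mul_pos h0 hω
  have hs : 0 < √(a * ω) := Real.sqrt_pos.2 hpos
  have hs1 : √(a * ω) < 1 := by rwa [Real.sqrt_lt' one_pos, one_pow]
  have hm : 0 < 1 - √(a * ω) := sub_pos.2 hs1
  have hsqrt : HasDerivAt (fun w => √(a * w)) (a * 1 / (2 * √(a * ω))) ω :=
    ((hasDerivAt_id' ω).const_mul a).sqrt hpos.ne'
  have hq : 0 < (1 + √(a * ω)) / (1 - √(a * ω)) := by positivity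
  have hlog := (((hsqrt.const_add 1).fun_div (hsqrt.const_sub 1) hm.ne').sqrt hq.ne').log
    (Real.sqrt_pos.2 hq).ne'
  refine ⟨_, ?_, hlog⟩
  have : 0 < a * 1 / (2 * √(a * ω)) * (1 - √(a * ω))
      - (1 + √(a * ω)) * -(a * 1 / (2 * √(a * ω))) := by
    have h3 : 0 < a * 1 / (2 * √(a * ω)) := by positivity
    nlinarith
  positivity

lemma integral_profile_pow {ω c : ℝ} (hω : 0 < ω) (hc : 1 ≤ c) (n : ℕ) :
    ∫ s : ℝ, √(4 * ω / (1 + 1 / c * Real.cosh (2 * √ω * s))) ^ (2 * n)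
      = (4 * ω * c) ^ n * ((2 * √ω)⁻¹ * ∫ x : ℝ, ((c + Real.cosh x) ^ n)⁻¹) := by
  have hs : 0 < 2 * √ω := by positivity
  have hc0 : 0 < c := by linarith
  have h := Measure.integral_comp_mul_left (fun x : ℝ => ((c + Real.cosh x) ^ n)⁻¹) (2 * √ω)
  rw [abs_of_pos (inv_pos.2 hs), smul_eq_mul] at h
  rw [← h, ← integral_const_mul]
  refine integral_congr_ae (ae_of_all _ fun x => ?_)
  have hcosh := Real.cosh_pos (2 * √ω * x)
  simp only
  rw [pow_mul, Real.sq_sqrt (by positivity), ← div_eq_mul_inv, ← div_pow]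
  congr 1
  field_simp

/-- With `α ≠ 0` fixed, the ratio `Λ_{d₂}(ω) = Λ₆(ω)/Λ₄(ω)` is
differentiable and strictly increasing (`dΛ_{d₂}/dω > 0`) for all `ω > 0` with
`0 < β(ω) < 1`, where `β(ω) = -16αω/3`. Consequently
`(dΛ_{d₂}/dω)/(dΛ₂₄/dω) < 0`, where `Λ₂₄ = Λ₂/Λ₄`. -/
theorem stmt16 (α : ℝ) (hα : α ≠ 0)
    (R0 : ℝ → ℝ → ℝ)
    (hR0 : ∀ ω z : ℝ, R0 ω z =
      Real.sqrt (4 * ω / (1 + Real.sqrt (1 - (-(16 / 3) * α * ω))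
        * Real.cosh (2 * Real.sqrt ω * z))))
    (Λ24 Λd2 : ℝ → ℝ)
    (hΛ24 : ∀ ω : ℝ, Λ24 ω = (∫ s : ℝ, (R0 ω s) ^ 2) / ∫ s : ℝ, (R0 ω s) ^ 4)
    (hΛd2 : ∀ ω : ℝ, Λd2 ω = (∫ s : ℝ, (R0 ω s) ^ 6) / ∫ s : ℝ, (R0 ω s) ^ 4) :
    ∀ ω : ℝ, 0 < ω → 0 < -(16 / 3) * α * ω → -(16 / 3) * α * ω < 1 →
      (DifferentiableAt ℝ Λd2 ω ∧ 0 < deriv Λd2 ω) ∧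
      deriv Λd2 ω / deriv Λ24 ω < 0 := by
  intro ω hω h0 h1
  set a : ℝ := -(16 / 3) * α with ha_def
  have ha : 0 < a := pos_of_mul_pos_left h0 hω.le
  have key : ∀ w, 0 < w → a * w < 1 →
      Λd2 w = 2 / a * (fun t => 3 - t * Real.sinh t ^ 2 /
        (Real.cosh t * (t * Real.cosh t - Real.sinh t))) (Real.artanh √(a * w)) ∧
      Λ24 w = a / 4 * (fun t => t * Real.cosh t / (t * Real.cosh t - Real.sinh t))
        (Real.artanh √(a * w)) := by
    intro w hw hw1
    have hpos : 0 < a * w := mul_pos ha hw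
    have hb : 0 < √(a * w) := Real.sqrt_pos.2 hpos
    have hb1 : √(a * w) < 1 := by rwa [Real.sqrt_lt' one_pos, one_pow]
    set θ := Real.artanh √(a * w) with hθ_def
    have hθ : 0 < θ := Real.artanh_pos ⟨hb, hb1⟩
    have hcosh : Real.cosh θ = 1 / √(1 - a * w) := by
      rw [hθ_def, Real.cosh_artanh ⟨by linarith, hb1⟩, Real.sq_sqrt hpos.le]
    have hk : √(1 - a * w) = 1 / Real.cosh θ := by rw [hcosh, one_div_one_div]
    have haw : a * w * Real.cosh θ ^ 2 = Real.sinh θ ^ 2 := by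
      have h2 : 0 < 1 - a * w := sub_pos.2 hw1
      have h3 : (1 - a * w) * Real.cosh θ ^ 2 = 1 := by
        rw [hcosh, div_pow, Real.sq_sqrt h2.le]
        field_simp
      linear_combination Real.cosh_sq θ - h3
    have hint : ∀ n : ℕ, ∫ s : ℝ, R0 w s ^ (2 * n) = (4 * w * Real.cosh θ) ^ n *
        ((2 * √w)⁻¹ * ∫ x : ℝ, ((Real.cosh θ + Real.cosh x) ^ n)⁻¹) := by
      intro n
      simp only [hR0, hk]
      exact integral_profile_pow hw (Real.one_le_cosh θ) n
    have i1 := hint 1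
    have i2 := hint 2
    have i3 := hint 3
    rw [integral_inv_cosh_add_cosh hθ] at i1
    rw [integral_inv_cosh_add_cosh_sq hθ] at i2
    rw [integral_inv_cosh_add_cosh_cube hθ] at i3
    norm_num only at i1 i2 i3
    have hs := Real.sinh_pos_iff.2 hθ
    have hc := Real.cosh_pos θ
    have hD : 0 < θ * Real.cosh θ - Real.sinh θ := sub_pos.2 (sinh_lt_self_mul_cosh hθ)
    have hD' : Real.cosh θ * θ - Real.sinh θ ≠ 0 := by
      rw [mul_comm]
      exact hD.ne'
    have hsw : 0 < √w := Real.sqrt_pos.2 hw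
    have hw_eq : w = Real.sinh θ ^ 2 / (a * Real.cosh θ ^ 2) := by
      rw [eq_div_iff (by positivity)]
      linear_combination haw
    rw [hΛd2, hΛ24, i1, i2, i3]
    generalize √w = r at hsw ⊢
    constructor
    · rw [hw_eq]
      field_simp
      ring
    · rw [hw_eq]
      field_simp
  have hnhds : ∀ᶠ w in 𝓝 ω, 0 < w ∧ a * w < 1 :=
    (eventually_gt_nhds hω).and
      (((continuous_const_mul a).tendsto ω).eventually (eventually_lt_nhds h1))
  have hb : 0 < √(a * ω) := Real.sqrt_pos.2 h0
  have hb1 : √(a * ω) < 1 := by rwa [Real.sqrt_lt' one_pos, one_pow]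
  have hθ : 0 < Real.artanh √(a * ω) := Real.artanh_pos ⟨hb, hb1⟩
  obtain ⟨dθ, hdθ, hθ'⟩ := exists_pos_hasDerivAt_artanh_sqrt ha hω h1
  obtain ⟨d, hd, hd'⟩ := exists_pos_hasDerivAt_sixth_moment_ratio hθ
  obtain ⟨e, he, he'⟩ := exists_neg_hasDerivAt_second_moment_ratio hθ
  have H1 : HasDerivAt Λd2 (2 / a * (d * dθ)) ω :=
    ((HasDerivAt.comp ω hd' hθ').const_mul (2 / a)).congr_of_eventuallyEq
      (hnhds.mono fun w hw => (key w hw.1 hw.2).1)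
  have H2 : HasDerivAt Λ24 (a / 4 * (e * dθ)) ω :=
    ((HasDerivAt.comp ω he' hθ').const_mul (a / 4)).congr_of_eventuallyEq
      (hnhds.mono fun w hw => (key w hw.1 hw.2).2)
  have P1 : 0 < 2 / a * (d * dθ) := by positivity
  have P2 : a / 4 * (e * dθ) < 0 :=
    mul_neg_of_pos_of_neg (by positivity) (mul_neg_of_neg_of_pos he hdθ)
  rw [H1.deriv, H2.deriv]
  exact ⟨⟨H1.differentiableAt, P1⟩, div_neg_of_pos_of_neg P1 P2⟩
end

section
/- Fix real parameters $a, b, d_2$ and fix $\omega_0 > 0$ with $0 < \beta(\omega_0) < 1$. Define $\Phi(\omega, d_1) = \frac{1}{2R_0(0;\omega)^2}\left(\Lambda_2'(\omega)a - \Lambda_2(\omega)b - \Lambda_4(\omega)d_1 - \Lambda_6(\omega)d_2\right)$ and $d_1^*(\omega_0) = \frac{1}{4}a - \Lambda_{24}(\omega_0)\,b - \Lambda_{d_2}(\omega_0)\left(d_2 - \frac{1}{3}\alpha a\right)$, where $\Lambda_{24} = \Lambda_2/\Lambda_4$ and $\Lambda_{d_2} = \Lambda_6/\Lambda_4$. Then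 holding $d_1 = d_1^*(\omega_0)$ fixed, $\frac{\partial\Phi}{\partial\omega}(\omega_0, d_1^*(\omega_0)) = -\frac{\Lambda_4(\omega_0)}{2R_0(0;\omega_0)^2}\left(\frac{d\Lambda_{24}}{d\omega}(\omega_0)\,b + \frac{d\Lambda_{d_2}}{d\omega}(\omega_0)\left(d_2 - \frac{1}{3}\alpha a\right)\right)$. -/
open MeasureTheory

lemma Real.one_add_sq_le_four_mul_cosh (x : ℝ) : 1 + x ^ 2 ≤ 4 * Real.cosh x := by
  have h1 := Real.quadratic_le_exp_of_nonneg (abs_nonneg x)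
  have h2 := Real.add_one_le_exp (-|x|)
  rw [← Real.cosh_abs, Real.cosh_eq, ← sq_abs x]
  nlinarith

lemma one_add_mul_cosh_pos {s : ℝ} (hs : 0 ≤ s) (t : ℝ) : 0 < 1 + s * Real.cosh t := by
  have := Real.cosh_pos t
  positivity

lemma continuous_inv_one_add_mul_cosh {s : ℝ} (hs : 0 ≤ s) :
    Continuous fun t : ℝ => (1 + s * Real.cosh t)⁻¹ :=
  Continuous.inv₀ (by fun_prop) fun t => (one_add_mul_cosh_pos hs t).ne'

lemma inv_one_add_mul_cosh_le_one {s : ℝ} (hs : 0 ≤ s) (t : ℝ) :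
    (1 + s * Real.cosh t)⁻¹ ≤ 1 := by
  have := Real.cosh_pos t
  exact inv_le_one_of_one_le₀ (le_add_of_nonneg_right (by positivity))

lemma mul_cosh_mul_inv_le_one {s : ℝ} (hs : 0 ≤ s) (t : ℝ) :
    s * Real.cosh t * (1 + s * Real.cosh t)⁻¹ ≤ 1 := by
  have := one_add_mul_cosh_pos hs t
  rw [← div_eq_mul_inv, div_le_one this]
  linarith

lemma integrable_inv_one_add_mul_cosh {s : ℝ} (hs : 0 < s) :
    Integrable fun t : ℝ => (1 + s * Real.cosh t)⁻¹ := by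
  refine (integrable_inv_one_add_sq.const_mul (4 / s)).mono'
    (continuous_inv_one_add_mul_cosh hs.le).aestronglyMeasurable (.of_forall fun t => ?_)
  have hq := one_add_mul_cosh_pos hs.le t
  have ht := Real.one_add_sq_le_four_mul_cosh t
  have : 0 < 1 + t ^ 2 := by positivity
  rw [Real.norm_of_nonneg (by positivity), ← div_eq_mul_inv, div_div, ← one_div,
    div_le_div_iff₀ hq (by positivity)]
  nlinarith

lemma integrable_inv_one_add_mul_cosh_pow {s : ℝ} (hs : 0 < s) (k : ℕ) :
    Integrable fun t : ℝ => (1 + s * Real.cosh t)⁻¹ ^ (k + 1) := by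
  refine (integrable_inv_one_add_mul_cosh hs).mono'
    ((continuous_inv_one_add_mul_cosh hs.le).pow _).aestronglyMeasurable
    (.of_forall fun t => ?_)
  have hq : 0 ≤ (1 + s * Real.cosh t)⁻¹ := (inv_pos.2 (one_add_mul_cosh_pos hs.le t)).le
  rw [Real.norm_of_nonneg (by positivity)]
  exact pow_le_of_le_one hq (inv_one_add_mul_cosh_le_one hs.le t) k.succ_ne_zero

lemma integral_inv_one_add_mul_cosh_pow_pos {s : ℝ} (hs : 0 < s) (k : ℕ) :
    0 < ∫ t : ℝ, (1 + s * Real.cosh t)⁻¹ ^ (k + 1) := by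
  have hpos : ∀ t : ℝ, 0 < (1 + s * Real.cosh t)⁻¹ ^ (k + 1) := fun t =>
    pow_pos (inv_pos.2 (one_add_mul_cosh_pos hs.le t)) _
  rw [integral_pos_iff_support_of_nonneg (fun t => (hpos t).le)
    (integrable_inv_one_add_mul_cosh_pow hs k),
    Function.support_eq_univ fun t => (hpos t).ne']
  simp

lemma differentiableAt_integral_inv_one_add_mul_cosh_pow {s₀ : ℝ} (hs : 0 < s₀) (k : ℕ) :
    DifferentiableAt ℝ (fun s => ∫ t : ℝ, (1 + s * Real.cosh t)⁻¹ ^ (k + 1)) s₀ := by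
  have hint : Integrable fun t : ℝ =>
      (k + 1) * ((2 / s₀) * (1 + (s₀ / 2) * Real.cosh t)⁻¹) :=
    ((integrable_inv_one_add_mul_cosh (half_pos hs)).const_mul _).const_mul _
  refine (hasDerivAt_integral_of_dominated_loc_of_deriv_le (𝕜 := ℝ)
    (F := fun s t => (1 + s * Real.cosh t)⁻¹ ^ (k + 1))
    (F' := fun s t => (k + 1) * (1 + s * Real.cosh t)⁻¹ ^ k *
      (-Real.cosh t * (1 + s * Real.cosh t)⁻¹ ^ 2))
    (Ioi_mem_nhds (half_lt_self hs)) ?_ (integrable_inv_one_add_mul_cosh_pow hs k) ?_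
    (.of_forall fun t s hst => ?_) hint
    (.of_forall fun t s hst => ?_)).2.differentiableAt
  · filter_upwards [Ioi_mem_nhds hs] with s hs'
    exact ((continuous_inv_one_add_mul_cosh (le_of_lt hs')).pow _).aestronglyMeasurable
  · have := continuous_inv_one_add_mul_cosh hs.le
    exact Continuous.aestronglyMeasurable (by fun_prop)
  · have hs' : s₀ / 2 < s := hst
    have hspos : 0 < s := (half_pos hs).trans hs'
    have hc := Real.cosh_pos t
    have hq := inv_pos.2 (one_add_mul_cosh_pos hspos.le t)
    have h1 := inv_one_add_mul_cosh_le_one hspos.le t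
    have h2 := mul_cosh_mul_inv_le_one hspos.le t
    have h3 : (1 + s * Real.cosh t)⁻¹ ≤ (1 + (s₀ / 2) * Real.cosh t)⁻¹ := by
      have := one_add_mul_cosh_pos (half_pos hs).le t
      gcongr
    set q := (1 + s * Real.cosh t)⁻¹
    have h4 : Real.cosh t * q ≤ 2 / s₀ := by
      rw [le_div_iff₀ hs]
      nlinarith [mul_pos hc hq]
    have h5 : ‖((k : ℝ) + 1) * q ^ k * (-Real.cosh t * q ^ 2)‖ =
        (k + 1) * (q ^ k * (Real.cosh t * q * q)) := by
      rw [show ((k : ℝ) + 1) * q ^ k * (-Real.cosh t * q ^ 2) =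
        -((k + 1) * (q ^ k * (Real.cosh t * q * q))) by ring, norm_neg,
        Real.norm_of_nonneg (by positivity)]
    rw [h5]
    have h6 : q ^ k ≤ 1 := pow_le_one₀ hq.le h1
    have h7 : Real.cosh t * q * q ≤ 2 / s₀ * (1 + (s₀ / 2) * Real.cosh t)⁻¹ := by gcongr
    have h8 : q ^ k * (Real.cosh t * q * q) ≤ 1 * (Real.cosh t * q * q) := by gcongr
    exact mul_le_mul_of_nonneg_left (by linarith) (by positivity)
  · have hspos : 0 < s := (half_pos hs).trans hst
    have hq := one_add_mul_cosh_pos hspos.le t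
    have h := ((((hasDerivAt_id s).mul_const (Real.cosh t)).const_add 1).inv hq.ne').pow (k + 1)
    refine h.congr_deriv ?_
    simp [field]

lemma integral_sqrt_soliton_pow {ω s : ℝ} (hω : 0 ≤ ω) (hs : 0 ≤ s) (k : ℕ) :
    ∫ z : ℝ, Real.sqrt (4 * ω / (1 + s * Real.cosh (2 * Real.sqrt ω * z))) ^ (2 * k) =
      (4 * ω) ^ k * (|(2 * Real.sqrt ω)⁻¹| * ∫ t : ℝ, (1 + s * Real.cosh t)⁻¹ ^ k) := by
  rw [← smul_eq_mul |_|, ← Measure.integral_comp_mul_left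
    (fun t => (1 + s * Real.cosh t)⁻¹ ^ k), ← integral_const_mul]
  refine integral_congr_ae (.of_forall fun z => ?_)
  have := one_add_mul_cosh_pos hs (2 * Real.sqrt ω * z)
  simp only
  rw [pow_mul, Real.sq_sqrt (by positivity), div_eq_mul_inv, mul_pow]

/-- Virial identity for the profile `R = √(4ω / (1 + s cosh(2√ω z)))`, which solves
`R'' = ωR - R³ - αR⁵` when `s² = 1 + (16/3)αω`. -/
lemma integral_deriv_sqrt_soliton_sq {α ω s : ℝ} (hω : 0 < ω) (hs : 0 < s)
    (hsq : s ^ 2 = 1 + 16 / 3 * α * ω) {R : ℝ → ℝ}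
    (hR : ∀ z, R z = Real.sqrt (4 * ω / (1 + s * Real.cosh (2 * Real.sqrt ω * z)))) :
    ∫ z : ℝ, deriv R z ^ 2 = (∫ z : ℝ, R z ^ 4) / 4 + α / 3 * ∫ z : ℝ, R z ^ 6 := by
  set c := 2 * Real.sqrt ω with hc
  have hc2 : c ^ 2 = 4 * ω := by rw [hc, mul_pow, Real.sq_sqrt hω.le]; ring
  have hc0 : 0 < c := by positivity
  set q : ℝ → ℝ := fun z => (1 + s * Real.cosh (c * z))⁻¹ with hq
  have hden : ∀ z, 0 < 1 + s * Real.cosh (c * z) := fun z => one_add_mul_cosh_pos hs.le _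
  have hqpos : ∀ z, 0 < q z := fun z => inv_pos.2 (hden z)
  have hqone : ∀ z, q z * (1 + s * Real.cosh (c * z)) = 1 := fun z => inv_mul_cancel₀ (hden z).ne'
  have hqcont : Continuous q := (continuous_inv_one_add_mul_cosh hs.le).comp (by fun_prop)
  have hqint : ∀ k : ℕ, Integrable fun z => q z ^ (k + 1) := fun k =>
    (integrable_inv_one_add_mul_cosh_pow hs k).comp_mul_left' hc0.ne'
  have hcosh : ∀ z, HasDerivAt (fun z => Real.cosh (c * z)) (c * Real.sinh (c * z)) z := fun z => by
    simpa [mul_comm] using ((hasDerivAt_id z).const_mul c).cosh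
  have hsinh : ∀ z, HasDerivAt (fun z => Real.sinh (c * z)) (c * Real.cosh (c * z)) z := fun z => by
    simpa [mul_comm] using ((hasDerivAt_id z).const_mul c).sinh
  have hqd : ∀ z, HasDerivAt q (-(s * c * Real.sinh (c * z) * q z ^ 2)) z := fun z => by
    refine ((((hcosh z).const_mul s).const_add 1).inv (hden z).ne').congr_deriv ?_
    simp only [hq, inv_pow, div_eq_mul_inv]
    ring
  have hRq : ∀ z, R z = Real.sqrt (4 * ω * q z) := fun z => by rw [hR, div_eq_mul_inv]
  have hR2 : ∀ z, R z ^ 2 = 4 * ω * q z := fun z => by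
    rw [hRq, Real.sq_sqrt (by have := hqpos z; positivity)]
  have hRd : ∀ z, deriv R z ^ 2 = 4 * ω ^ 2 * (s ^ 2 * Real.sinh (c * z) ^ 2 * q z ^ 3) := fun z => by
    have hpos : 0 < 4 * ω * q z := by have := hqpos z; positivity
    have h := ((hqd z).const_mul (4 * ω)).sqrt hpos.ne'
    rw [show R = fun z => Real.sqrt (4 * ω * q z) from funext hRq, h.deriv, div_pow, mul_pow,
      mul_pow 2, Real.sq_sqrt hpos.le]
    have := (hqpos z).ne'
    field_simp
    rw [hc2]
    ring
  have hR4 : ∀ z, R z ^ 4 = 16 * ω ^ 2 * q z ^ 2 := fun z => by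
    rw [show R z ^ 4 = (R z ^ 2) ^ 2 by ring, hR2]; ring
  have hR6 : ∀ z, R z ^ 6 = 64 * ω ^ 3 * q z ^ 3 := fun z => by
    rw [show R z ^ 6 = (R z ^ 2) ^ 3 by ring, hR2]; ring
  have hsc : ∀ z, s * |Real.sinh (c * z)| * q z ≤ 1 := fun z => by
    have h1 := mul_cosh_mul_inv_le_one hs.le (c * z)
    have h2 : |Real.sinh (c * z)| ≤ Real.cosh (c * z) := by
      rw [Real.abs_sinh, ← Real.cosh_abs]
      exact (Real.sinh_lt_cosh _).le
    refine le_trans ?_ h1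
    have := hqpos z
    change _ ≤ s * Real.cosh (c * z) * q z
    gcongr
  have hqint1 : Integrable q := by simpa using hqint 0
  have hgint : Integrable fun z => s * Real.sinh (c * z) * q z ^ 2 := by
    refine hqint1.mono' (Continuous.aestronglyMeasurable (by fun_prop)) (.of_forall fun z => ?_)
    have hp := hqpos z
    have := hsc z
    rw [Real.norm_eq_abs, abs_mul, abs_mul, abs_of_pos hs, abs_of_pos (pow_pos hp 2)]
    nlinarith
  have hEint : Integrable fun z => s ^ 2 * Real.sinh (c * z) ^ 2 * q z ^ 3 := by
    refine hqint1.mono' (Continuous.aestronglyMeasurable (by fun_prop)) (.of_forall fun z => ?_)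
    have hp := hqpos z
    have h1 := hsc z
    rw [Real.norm_of_nonneg (by positivity), ← sq_abs (Real.sinh _)]
    have h2 : (s * |Real.sinh (c * z)| * q z) ^ 2 ≤ 1 := pow_le_one₀ (by positivity) h1
    nlinarith
  have hDint : Integrable fun z => deriv R z ^ 2 := by
    simp only [hRd]; exact hEint.const_mul _
  have h4int : Integrable fun z => R z ^ 4 := by
    simp only [hR4]; exact (hqint 1).const_mul _
  have h6int : Integrable fun z => R z ^ 6 := by
    simp only [hR6]; exact (hqint 2).const_mul _
  -- `(R²)'/4` is a primitive of `R'² - R⁴/4 - αR⁶/3`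
  have hprim : ∀ z, HasDerivAt (fun z => -(ω * c) * (s * Real.sinh (c * z) * q z ^ 2))
      (deriv R z ^ 2 - (1 / 4 * R z ^ 4 + α / 3 * R z ^ 6)) z := fun z => by
    refine ((((hsinh z).const_mul s).mul ((hqd z).pow 2)).const_mul (-(ω * c))).congr_deriv ?_
    rw [hRd, hR4, hR6]
    have e1 := hqone z
    have e2 := Real.cosh_sq (c * z)
    simp only [Pi.pow_apply]
    generalize q z = Q at *
    generalize Real.cosh (c * z) = C at *
    generalize Real.sinh (c * z) = S at *
    have hαω : 16 / 3 * α * ω = s ^ 2 - 1 := by linarith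
    push_cast
    have e3 : α / 3 * (64 * ω ^ 3 * Q ^ 3) = 4 * ω ^ 2 * (s ^ 2 - 1) * Q ^ 3 := by
      rw [← hαω]; ring
    rw [e3]
    have e4 : c * c = 4 * ω := by rw [← hc2]; ring
    linear_combination (-ω * s * C * Q ^ 2 + 2 * ω * s ^ 2 * S ^ 2 * Q ^ 3) * e4 +
      (4 * ω ^ 2 * s * C * Q ^ 2 - 4 * ω ^ 2 * Q ^ 2) * e1 - 4 * ω ^ 2 * s ^ 2 * Q ^ 3 * e2
  have h0 := integral_eq_zero_of_hasDerivAt_of_integrable hprim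
    (hDint.sub ((h4int.const_mul _).add (h6int.const_mul _))) (hgint.const_mul _)
  have hsub : ∫ z, (deriv R z ^ 2 - (1 / 4 * R z ^ 4 + α / 3 * R z ^ 6)) =
      (∫ z, deriv R z ^ 2) - ∫ z, (1 / 4 * R z ^ 4 + α / 3 * R z ^ 6) :=
    integral_sub hDint ((h4int.const_mul _).add (h6int.const_mul _))
  rw [hsub, integral_add (h4int.const_mul _) (h6int.const_mul _), integral_const_mul,
    integral_const_mul] at h0
  linarith

open MeasureTheory

/-- With `Φ(ω, d₁) = (1/(2R₀(0;ω)²))(Λ₂'(ω)a - Λ₂(ω)b - Λ₄(ω)d₁ - Λ₆(ω)d₂)`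
and `d₁* = (1/4)a - Λ₂₄(ω₀)b - Λ_{d₂}(ω₀)(d₂ - (1/3)αa)`, holding `d₁ = d₁*` fixed,
`∂Φ/∂ω(ω₀, d₁*) = -(Λ₄(ω₀)/(2R₀(0;ω₀)²))((dΛ₂₄/dω)(ω₀) b + (dΛ_{d₂}/dω)(ω₀)(d₂ - (1/3)αa))`. -/
theorem stmt18 (α a b d2 ω0 : ℝ) (hα : α ≠ 0) (hω0 : 0 < ω0)
    (hβ0 : 0 < -(16 / 3) * α * ω0) (hβ1 : -(16 / 3) * α * ω0 < 1)
    (R0 : ℝ → ℝ → ℝ)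
    (hR0 : ∀ ω z : ℝ, R0 ω z =
      Real.sqrt (4 * ω / (1 + Real.sqrt (1 - (-(16 / 3) * α * ω))
        * Real.cosh (2 * Real.sqrt ω * z))))
    (Λ2 Λ4 Λ6 Λ2' Λ24 Λd2 : ℝ → ℝ)
    (hΛ2 : ∀ ω : ℝ, Λ2 ω = ∫ s : ℝ, (R0 ω s) ^ 2)
    (hΛ4 : ∀ ω : ℝ, Λ4 ω = ∫ s : ℝ, (R0 ω s) ^ 4)
    (hΛ6 : ∀ ω : ℝ, Λ6 ω = ∫ s : ℝ, (R0 ω s) ^ 6)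
    (hΛ2' : ∀ ω : ℝ, Λ2' ω = ∫ s : ℝ, (deriv (fun z => R0 ω z) s) ^ 2)
    (hΛ24 : ∀ ω : ℝ, Λ24 ω = Λ2 ω / Λ4 ω)
    (hΛd2 : ∀ ω : ℝ, Λd2 ω = Λ6 ω / Λ4 ω)
    (Φ : ℝ → ℝ → ℝ)
    (hΦ : ∀ ω d1 : ℝ, Φ ω d1 = (1 / (2 * (R0 ω 0) ^ 2)) *
      (Λ2' ω * a - Λ2 ω * b - Λ4 ω * d1 - Λ6 ω * d2))
    (d1star : ℝ)
    (hd1star : d1star = (1 / 4) * a - Λ24 ω0 * b - Λd2 ω0 * (d2 - (1 / 3) * α * a)) :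
    deriv (fun ω => Φ ω d1star) ω0 =
      -(Λ4 ω0 / (2 * (R0 ω0 0) ^ 2)) *
        (deriv Λ24 ω0 * b + deriv Λd2 ω0 * (d2 - (1 / 3) * α * a)) := by
  have hev : ∀ᶠ ω in nhds ω0, 0 < ω ∧ 0 < 1 - (-(16 / 3) * α * ω) := by
    refine (eventually_gt_nhds hω0).and ?_
    have hcont : Continuous fun ω : ℝ => 1 - (-(16 / 3) * α * ω) := by fun_prop
    exact hcont.continuousAt.eventually_const_lt (by linarith)
  have hdiff : ∀ (k : ℕ) (Λ : ℝ → ℝ), (∀ ω, Λ ω = ∫ s : ℝ, R0 ω s ^ (2 * (k + 1))) →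
      DifferentiableAt ℝ Λ ω0 := fun k Λ hΛ => by
    have hs : 0 < Real.sqrt (1 - (-(16 / 3) * α * ω0)) := Real.sqrt_pos.2 (by linarith)
    have hs' : DifferentiableAt ℝ (fun ω => Real.sqrt (1 - (-(16 / 3) * α * ω))) ω0 :=
      DifferentiableAt.sqrt (by fun_prop) (by linarith)
    have hI := (differentiableAt_integral_inv_one_add_mul_cosh_pow hs k).fun_comp' ω0 hs'
    have hω : DifferentiableAt ℝ (fun ω => (2 * Real.sqrt ω)⁻¹) ω0 :=
      ((differentiableAt_id.sqrt hω0.ne').const_mul 2).inv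
        (mul_pos two_pos (Real.sqrt_pos.2 hω0)).ne'
    have hA : DifferentiableAt ℝ (fun ω : ℝ => (4 * ω) ^ (k + 1)) ω0 := by fun_prop
    refine (hA.mul (hω.mul hI)).congr_of_eventuallyEq ?_
    filter_upwards [hev] with ω hω'
    rw [hΛ]
    simp only [hR0]
    rw [integral_sqrt_soliton_pow hω'.1.le (Real.sqrt_nonneg _),
      abs_of_nonneg (by positivity)]
    rfl
  have hd2 := hdiff 0 Λ2 hΛ2
  have hd4 := hdiff 1 Λ4 hΛ4
  have hd6 := hdiff 2 Λ6 hΛ6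
  have hvir : ∀ᶠ ω in nhds ω0, Λ2' ω = Λ4 ω / 4 + α / 3 * Λ6 ω := by
    filter_upwards [hev] with ω hω
    rw [hΛ2', hΛ4, hΛ6]
    refine integral_deriv_sqrt_soliton_sq hω.1 (Real.sqrt_pos.2 hω.2) ?_ (hR0 ω)
    rw [Real.sq_sqrt hω.2.le]
    ring
  have hR0pos : 0 < R0 ω0 0 := by
    rw [hR0]
    have := one_add_mul_cosh_pos (Real.sqrt_nonneg (1 - (-(16 / 3) * α * ω0)))
      (2 * Real.sqrt ω0 * 0)
    positivity
  have hR0d : DifferentiableAt ℝ (fun ω => R0 ω 0) ω0 := by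
    simp only [hR0, mul_zero, Real.cosh_zero, mul_one]
    have hs' : DifferentiableAt ℝ (fun ω => Real.sqrt (1 - (-(16 / 3) * α * ω))) ω0 :=
      DifferentiableAt.sqrt (by fun_prop) (by linarith)
    have hne : 0 < 1 + Real.sqrt (1 - (-(16 / 3) * α * ω0)) := by positivity
    exact ((differentiableAt_id.const_mul 4).div (hs'.const_add 1) hne.ne').sqrt
      (div_pos (mul_pos four_pos hω0) hne).ne'
  have h4pos : 0 < Λ4 ω0 := by
    rw [hΛ4]
    simp only [hR0]
    rw [integral_sqrt_soliton_pow hω0.le (Real.sqrt_nonneg _) 2]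
    have := integral_inv_one_add_mul_cosh_pow_pos (Real.sqrt_pos.2
      (show 0 < 1 - (-(16 / 3) * α * ω0) by linarith)) 1
    positivity
  have h4ev : ∀ᶠ ω in nhds ω0, 0 < Λ4 ω := hd4.continuousAt.eventually_const_lt h4pos
  have hd24 : DifferentiableAt ℝ Λ24 ω0 := by
    rw [funext hΛ24]; exact hd2.div hd4 h4pos.ne'
  have hdd2 : DifferentiableAt ℝ Λd2 ω0 := by
    rw [funext hΛd2]; exact hd6.div hd4 h4pos.ne'
  have hP : DifferentiableAt ℝ (fun ω => Λ4 ω / (2 * R0 ω 0 ^ 2)) ω0 :=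
    hd4.div ((hR0d.pow 2).const_mul 2) (by positivity)
  have hB := (((hd24.hasDerivAt.mul_const b).const_sub (1 / 4 * a - d1star)).sub
    (hdd2.hasDerivAt.mul_const (d2 - 1 / 3 * α * a)))
  have hΦeq : (fun ω => Φ ω d1star) =ᶠ[nhds ω0] fun ω => Λ4 ω / (2 * R0 ω 0 ^ 2) *
      (1 / 4 * a - d1star - Λ24 ω * b - Λd2 ω * (d2 - 1 / 3 * α * a)) := by
    filter_upwards [hvir, h4ev] with ω h1 h2
    rw [hΦ, hΛ24, hΛd2, h1]
    field_simp
    ring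
  rw [hΦeq.deriv_eq]
  refine (hP.hasDerivAt.mul hB).deriv.trans ?_
  simp only [Pi.sub_apply, hd1star]
  ring
end

section
/- Fix real parameters $a, b, d_2$ and fix $\omega_0 > 0$ with $0 < \beta(\omega_0) < 1$. Define $\Phi(\omega, d_1)$, $d_1^*(\omega_0)$, $\Lambda_{24} = \Lambda_2/\Lambda_4$, $\Lambda_{d_2} = \Lambda_6/\Lambda_4$ as follows: $\Phi(\omega, d_1) = \frac{1}{2R_0(0;\omega)^2}\left(\Lambda_2'(\omega)a - \Lambda_2(\omega)b - \Lambda_4(\omega)d_1 - \Lambda_6(\omega)d_2\right)$ and $d_1^*(\omega_0) = \frac{1}{4}a - \Lambda_{24}(\omega_0)\,b - \Lambda_{d_2}(\omega_0)\left(d_2 - \frac{1}{3}\alpha a\right)$. Set $b^* = -\frac{(d\Lambda_{d_2}/d\omega)(\omega_0)}{(d\Lambda_{24}/d\omega)(\omega_0)}\left(d_2 - \frac{1}{3}\alpha a\right)$. Then, holding $d_1 = d_1^*(\omega_0)$ fixed: if $b > b^*$ then $\frac{\partial\Phi}{\partial\omega}(\omega_0, d_1^*(\omega_0)) > 0$,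 and if $b < b^*$ then $\frac{\partial\Phi}{\partial\omega}(\omega_0, d_1^*(\omega_0)) < 0$. -/
open MeasureTheory

open Filter Topology

/-- The even, exponentially localised profile `1 / (1 + s cosh x)`. -/
noncomputable def coshProfile (s x : ℝ) : ℝ := (1 + s * Real.cosh x)⁻¹

lemma coshProfile_denom_pos {s : ℝ} (hs : 0 < s) (x : ℝ) : 0 < 1 + s * Real.cosh x := by
  have := Real.cosh_pos x
  positivity

lemma coshProfile_pos {s : ℝ} (hs : 0 < s) (x : ℝ) : 0 < coshProfile s x :=
  inv_pos.2 (coshProfile_denom_pos hs x)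

lemma coshProfile_le_one {s : ℝ} (hs : 0 < s) (x : ℝ) : coshProfile s x ≤ 1 := by
  refine inv_le_one_of_one_le₀ ?_
  have := mul_pos hs (Real.cosh_pos x)
  linarith

lemma coshProfile_neg (s x : ℝ) : coshProfile s (-x) = coshProfile s x := by
  simp [coshProfile]

lemma continuous_coshProfile {s : ℝ} (hs : 0 < s) : Continuous (coshProfile s) := by
  unfold coshProfile
  exact Continuous.inv₀ (by fun_prop) fun x => (coshProfile_denom_pos hs x).ne'

lemma hasDerivAt_coshProfile {s : ℝ} (hs : 0 < s) (x : ℝ) :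
    HasDerivAt (coshProfile s) (-(s * Real.sinh x) * coshProfile s x ^ 2) x := by
  have h := (((Real.hasDerivAt_cosh x).const_mul s).const_add 1).inv
    (coshProfile_denom_pos hs x).ne'
  refine h.congr_deriv ?_
  rw [coshProfile]
  field_simp

lemma mul_cosh_eq (s x : ℝ) : s * Real.cosh x = 1 / coshProfile s x - 1 := by
  simp [coshProfile]

lemma sq_mul_sinh_eq {s k : ℝ} (hs : 0 < s) (hsk : s ^ 2 + k ^ 2 = 1) (x : ℝ) :
    (s * Real.sinh x) ^ 2 * coshProfile s x ^ 2 =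
      1 - 2 * coshProfile s x + k ^ 2 * coshProfile s x ^ 2 := by
  have h1 := mul_cosh_eq s x
  have h2 := (coshProfile_pos hs x).ne'
  have h3 : (s * Real.sinh x) ^ 2 = (s * Real.cosh x) ^ 2 - s ^ 2 := by
    rw [mul_pow, Real.sinh_sq]; ring
  rw [h3, h1, show s ^ 2 = 1 - k ^ 2 by linarith]
  field_simp
  ring

lemma one_add_sq_div_four_le_cosh (x : ℝ) : 1 + x ^ 2 / 4 ≤ Real.cosh x := by
  rw [← Real.cosh_abs, ← sq_abs, Real.cosh_eq]
  have h1 := Real.quadratic_le_exp_of_nonneg (abs_nonneg x)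
  have h2 := Real.add_one_le_exp (-|x|)
  linarith

lemma integrable_coshProfile_pow {s : ℝ} (hs : 0 < s) {n : ℕ} (hn : n ≠ 0) :
    Integrable fun x => coshProfile s x ^ n := by
  refine (integrable_inv_one_add_sq.const_mul (4 / s)).mono'
    ((continuous_coshProfile hs).pow n).aestronglyMeasurable (ae_of_all _ fun x => ?_)
  rw [Real.norm_of_nonneg (pow_nonneg (coshProfile_pos hs x).le n)]
  refine (pow_le_of_le_one (coshProfile_pos hs x).le (coshProfile_le_one hs x) hn).trans ?_
  have hc := one_add_sq_div_four_le_cosh x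
  rw [show 4 / s * (1 + x ^ 2)⁻¹ = (s / 4 * (1 + x ^ 2))⁻¹ by field_simp]
  exact inv_anti₀ (by positivity) (by nlinarith [mul_le_mul_of_nonneg_left hc hs.le])

lemma coshProfile_eq_exp {s : ℝ} (x : ℝ) :
    coshProfile s x = 2 * Real.exp (-x) / (s + 2 * Real.exp (-x) + s * Real.exp (-x) ^ 2) := by
  have h := Real.exp_pos x
  rw [coshProfile, Real.cosh_eq, Real.exp_neg]
  field_simp
  congr 1
  ring

lemma tendsto_coshProfile_atTop {s : ℝ} (hs : 0 < s) :
    Tendsto (coshProfile s) atTop (𝓝 0) := by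
  have h : ContinuousAt (fun v : ℝ => 2 * v / (s + 2 * v + s * v ^ 2)) 0 :=
    ContinuousAt.div (by fun_prop) (by fun_prop) (by simpa using hs.ne')
  have h2 := h.tendsto.comp Real.tendsto_exp_neg_atTop_nhds_zero
  simp only [mul_zero, zero_div] at h2
  exact h2.congr fun x => (coshProfile_eq_exp x).symm

lemma tendsto_sinh_mul_coshProfile_atTop {s : ℝ} (hs : 0 < s) :
    Tendsto (fun x => s * Real.sinh x * coshProfile s x) atTop (𝓝 1) := by
  have h : ContinuousAt (fun v : ℝ => s * (1 - v ^ 2) / (s + 2 * v + s * v ^ 2)) 0 :=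
    ContinuousAt.div (by fun_prop) (by fun_prop) (by simpa using hs.ne')
  have h2 := h.tendsto.comp Real.tendsto_exp_neg_atTop_nhds_zero
  have h3 : s * (1 - (0 : ℝ) ^ 2) / (s + 2 * 0 + s * 0 ^ 2) = 1 := by
    simp [hs.ne']
  rw [h3] at h2
  refine h2.congr fun x => ?_
  have := Real.exp_pos x
  rw [coshProfile_eq_exp, Real.sinh_eq, Function.comp_apply, Real.exp_neg]
  field_simp

lemma tendsto_sinh_mul_coshProfile_atBot {s : ℝ} (hs : 0 < s) :
    Tendsto (fun x => s * Real.sinh x * coshProfile s x) atBot (𝓝 (-1)) := by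
  have h := ((tendsto_sinh_mul_coshProfile_atTop hs).comp tendsto_neg_atBot_atTop).neg
  refine h.congr fun x => ?_
  simp [coshProfile_neg]

lemma tendsto_coshProfile_atBot {s : ℝ} (hs : 0 < s) :
    Tendsto (coshProfile s) atBot (𝓝 0) :=
  ((tendsto_coshProfile_atTop hs).comp tendsto_neg_atBot_atTop).congr fun x =>
    coshProfile_neg s x

lemma integral_coshProfile {s k : ℝ} (hs : 0 < s) (hk : 0 < k) (hsk : s ^ 2 + k ^ 2 = 1) :
    ∫ x, coshProfile s x = Real.log ((1 + k) / (1 - k)) / k := by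
  have hk1 : 0 < 1 - k := by nlinarith
  have hint : Integrable (coshProfile s) := by
    simpa using integrable_coshProfile_pow hs one_ne_zero
  have hder : ∀ x, HasDerivAt (fun x => (Real.log (s * Real.exp x + (1 - k)) -
      Real.log (s * Real.exp x + (1 + k))) / k) (coshProfile s x) x := by
    intro x
    have he := Real.exp_pos x
    have h1 : s * Real.exp x + (1 - k) ≠ 0 := by positivity
    have h2 : s * Real.exp x + (1 + k) ≠ 0 := by positivity
    have h := (((((Real.hasDerivAt_exp x).const_mul s).add_const (1 - k)).log h1).sub
      ((((Real.hasDerivAt_exp x).const_mul s).add_const (1 + k)).log h2)).div_const k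
    refine h.congr_deriv ?_
    have h3 : s * (Real.exp x) ^ 2 + 2 * Real.exp x + s ≠ 0 := by positivity
    have h4 : (s * Real.exp x + (1 - k)) * (s * Real.exp x + (1 + k)) =
        s * (s * (Real.exp x) ^ 2 + 2 * Real.exp x + s) := by linear_combination (-1) * hsk
    have h5 : coshProfile s x = 2 * Real.exp x / (s * (Real.exp x) ^ 2 + 2 * Real.exp x + s) := by
      rw [coshProfile, Real.cosh_eq, Real.exp_neg]
      field_simp
      ring_nf
    rw [h5, div_sub_div _ _ h1 h2, h4]
    field_simp
    ring
  have htop : Tendsto (fun x => (Real.log (s * Real.exp x + (1 - k)) -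
      Real.log (s * Real.exp x + (1 + k))) / k) atTop (𝓝 0) := by
    have h : ContinuousAt (fun v : ℝ => (Real.log (s + (1 - k) * v) -
        Real.log (s + (1 + k) * v)) / k) 0 := by
      refine ContinuousAt.div_const (ContinuousAt.sub ?_ ?_) k <;>
      exact ContinuousAt.log (by fun_prop) (by simpa using hs.ne')
    have h2 := h.tendsto.comp Real.tendsto_exp_neg_atTop_nhds_zero
    simp only [mul_zero, sub_self, zero_div] at h2
    refine h2.congr fun x => ?_
    have he := Real.exp_pos x
    have e1 : s + (1 - k) * Real.exp (-x) = (s * Real.exp x + (1 - k)) * Real.exp (-x) := by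
      rw [Real.exp_neg]; field_simp
    have e2 : s + (1 + k) * Real.exp (-x) = (s * Real.exp x + (1 + k)) * Real.exp (-x) := by
      rw [Real.exp_neg]; field_simp
    rw [Function.comp_apply, e1, e2, Real.log_mul (by positivity) (Real.exp_pos _).ne',
      Real.log_mul (by positivity) (Real.exp_pos _).ne']
    ring
  have hbot : Tendsto (fun x => (Real.log (s * Real.exp x + (1 - k)) -
      Real.log (s * Real.exp x + (1 + k))) / k) atBot
      (𝓝 ((Real.log (1 - k) - Real.log (1 + k)) / k)) := by
    have h : ContinuousAt (fun v : ℝ => (Real.log (s * v + (1 - k)) -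
        Real.log (s * v + (1 + k))) / k) 0 := by
      refine ContinuousAt.div_const (ContinuousAt.sub ?_ ?_) k
      · exact ContinuousAt.log (by fun_prop) (by simpa using hk1.ne')
      · exact ContinuousAt.log (by fun_prop) (by simpa using (by linarith : 0 < 1 + k).ne')
    have h2 := h.tendsto.comp Real.tendsto_exp_atBot
    simpa [Function.comp_def] using h2
  rw [integral_of_hasDerivAt_of_tendsto hder hint hbot htop,
    Real.log_div (by positivity) hk1.ne']
  ring

lemma integral_coshProfile_sq {s k : ℝ} (hs : 0 < s) (hsk : s ^ 2 + k ^ 2 = 1) :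
    (∫ x, coshProfile s x) - k ^ 2 * ∫ x, coshProfile s x ^ 2 = 2 := by
  have hint : Integrable (coshProfile s) := by
    simpa using integrable_coshProfile_pow hs one_ne_zero
  have hint2 := (integrable_coshProfile_pow hs two_ne_zero).const_mul (k ^ 2)
  have hder : ∀ x, HasDerivAt (fun x => s * Real.sinh x * coshProfile s x)
      (coshProfile s x - k ^ 2 * coshProfile s x ^ 2) x := by
    intro x
    have h := ((Real.hasDerivAt_sinh x).const_mul s).mul (hasDerivAt_coshProfile hs x)
    refine h.congr_deriv ?_
    have h0 := (coshProfile_pos hs x).ne'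
    have hc : s * Real.cosh x * coshProfile s x = 1 - coshProfile s x := by
      rw [mul_cosh_eq s x]; field_simp
    linear_combination hc - sq_mul_sinh_eq hs hsk x
  have := integral_of_hasDerivAt_of_tendsto hder (hint.sub hint2)
    (tendsto_sinh_mul_coshProfile_atBot hs) (tendsto_sinh_mul_coshProfile_atTop hs)
  rw [integral_sub hint hint2, integral_const_mul] at this
  linarith

lemma integral_coshProfile_cube {s k : ℝ} (hs : 0 < s) (hsk : s ^ 2 + k ^ 2 = 1) :
    (∫ x, coshProfile s x) - 3 * (∫ x, coshProfile s x ^ 2) +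
      2 * k ^ 2 * (∫ x, coshProfile s x ^ 3) = 0 := by
  have hint : Integrable (coshProfile s) := by
    simpa using integrable_coshProfile_pow hs one_ne_zero
  have hint2 := (integrable_coshProfile_pow hs two_ne_zero).const_mul 3
  have hint3 := (integrable_coshProfile_pow hs three_ne_zero).const_mul (2 * k ^ 2)
  have hder : ∀ x, HasDerivAt (fun x => -(s * Real.sinh x * coshProfile s x) * coshProfile s x)
      (coshProfile s x - 3 * coshProfile s x ^ 2 + 2 * k ^ 2 * coshProfile s x ^ 3) x := by
    intro x
    have h := ((((Real.hasDerivAt_sinh x).const_mul s).mul (hasDerivAt_coshProfile hs x)).neg).mul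
      (hasDerivAt_coshProfile hs x)
    refine h.congr_deriv ?_
    have h0 := (coshProfile_pos hs x).ne'
    have hc : s * Real.cosh x * coshProfile s x = 1 - coshProfile s x := by
      rw [mul_cosh_eq s x]; field_simp
    simp only [Pi.neg_apply, Pi.mul_apply]
    linear_combination (-coshProfile s x) * hc + 2 * coshProfile s x * sq_mul_sinh_eq hs hsk x
  have h := integral_of_hasDerivAt_of_tendsto hder ((hint.sub hint2).add hint3)
    ((tendsto_sinh_mul_coshProfile_atBot hs).neg.mul (tendsto_coshProfile_atBot hs))
    ((tendsto_sinh_mul_coshProfile_atTop hs).neg.mul (tendsto_coshProfile_atTop hs))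
  rw [integral_add (by exact hint.sub hint2) hint3, integral_sub hint hint2, integral_const_mul,
    integral_const_mul] at h
  linarith

lemma two_mul_lt_log_div {k : ℝ} (hk : 0 < k) (hk1 : k < 1) :
    2 * k < Real.log ((1 + k) / (1 - k)) := by
  have h1 : 0 < 1 - k := by linarith
  have h := Real.lt_log_one_add_of_pos (x := 2 * k / (1 - k)) (by positivity)
  convert h using 1
  · field_simp
    ring
  · congr 1
    field_simp
    ring

lemma log_div_lt {k : ℝ} (hk : 0 < k) (hk1 : k < 1) :
    Real.log ((1 + k) / (1 - k)) < 2 * k / (1 - k ^ 2) := by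
  have h1 : 0 < 1 - k := by linarith
  have h2 : 0 < Real.log ((1 + k) / (1 - k)) := by linarith [two_mul_lt_log_div hk hk1]
  have h := Real.self_lt_sinh_iff.2 h2
  rw [Real.sinh_log (by positivity)] at h
  convert h using 1
  rw [show 1 - k ^ 2 = (1 - k) * (1 + k) by ring]
  field_simp
  ring

/-- The standing wave `(4ω / (1 + s cosh (2 √ω z)))^(1/2)`. -/
noncomputable def solitonWave (ω s z : ℝ) : ℝ :=
  Real.sqrt (4 * ω / (1 + s * Real.cosh (2 * Real.sqrt ω * z)))

lemma solitonWave_eq (ω s z : ℝ) :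
    solitonWave ω s z = Real.sqrt (4 * ω * coshProfile s (2 * Real.sqrt ω * z)) := rfl

lemma solitonWave_sq {ω s : ℝ} (hω : 0 < ω) (hs : 0 < s) (z : ℝ) :
    solitonWave ω s z ^ 2 = 4 * ω * coshProfile s (2 * Real.sqrt ω * z) := by
  have := coshProfile_pos hs (2 * Real.sqrt ω * z)
  rw [solitonWave_eq, Real.sq_sqrt (by positivity)]

lemma integral_comp_two_mul_sqrt {ω : ℝ} (hω : 0 < ω) (g : ℝ → ℝ) :
    ∫ z, g (2 * Real.sqrt ω * z) = (∫ x, g x) / (2 * Real.sqrt ω) := by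
  have hr := Real.sqrt_pos.2 hω
  rw [Measure.integral_comp_mul_left, abs_of_pos (by positivity), smul_eq_mul, div_eq_inv_mul]

lemma integral_solitonWave_pow {ω s : ℝ} (hω : 0 < ω) (hs : 0 < s) (n : ℕ) :
    ∫ z, solitonWave ω s z ^ (2 * n) =
      (4 * ω) ^ n * (∫ x, coshProfile s x ^ n) / (2 * Real.sqrt ω) := by
  simp_rw [pow_mul, solitonWave_sq hω hs, mul_pow _ (coshProfile s _)]
  rw [integral_const_mul, integral_comp_two_mul_sqrt hω fun x => coshProfile s x ^ n]
  ring

lemma deriv_solitonWave_sq {ω s k : ℝ} (hω : 0 < ω) (hs : 0 < s) (hsk : s ^ 2 + k ^ 2 = 1)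
    (z : ℝ) : deriv (solitonWave ω s) z ^ 2 =
      4 * ω ^ 2 * (coshProfile s (2 * Real.sqrt ω * z) - 2 * coshProfile s (2 * Real.sqrt ω * z) ^ 2
        + k ^ 2 * coshProfile s (2 * Real.sqrt ω * z) ^ 3) := by
  have hJ := coshProfile_pos hs (2 * Real.sqrt ω * z)
  have hlin : HasDerivAt (fun z => 2 * Real.sqrt ω * z) (2 * Real.sqrt ω) z := by
    simpa using (hasDerivAt_id z).const_mul (2 * Real.sqrt ω)
  have h := (((hasDerivAt_coshProfile hs (2 * Real.sqrt ω * z)).comp z hlin).const_mul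
    (4 * ω)).sqrt (by simp only [Function.comp_apply]; positivity)
  have h' : HasDerivAt (solitonWave ω s) _ z := h
  rw [h'.deriv, div_pow, mul_pow, mul_pow _ (Real.sqrt _), mul_pow _ (2 * Real.sqrt ω),
    Function.comp_apply, Real.sq_sqrt (by positivity), mul_pow, mul_pow 2 (Real.sqrt ω), Real.sq_sqrt hω.le]
  have hsq := sq_mul_sinh_eq hs hsk (2 * Real.sqrt ω * z)
  rw [div_eq_iff (by positivity)]
  linear_combination 64 * ω ^ 3 * coshProfile s (2 * Real.sqrt ω * z) ^ 2 * hsq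

lemma integral_deriv_solitonWave_sq {ω s k : ℝ} (hω : 0 < ω) (hs : 0 < s)
    (hsk : s ^ 2 + k ^ 2 = 1) :
    ∫ z, deriv (solitonWave ω s) z ^ 2 = 4 * ω ^ 2 * ((∫ x, coshProfile s x)
      - 2 * (∫ x, coshProfile s x ^ 2) + k ^ 2 * ∫ x, coshProfile s x ^ 3) / (2 * Real.sqrt ω) := by
  have hint : Integrable (coshProfile s) := by
    simpa using integrable_coshProfile_pow hs one_ne_zero
  have hint2 := (integrable_coshProfile_pow hs two_ne_zero).const_mul 2
  have hint3 := (integrable_coshProfile_pow hs three_ne_zero).const_mul (k ^ 2)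
  simp_rw [deriv_solitonWave_sq hω hs hsk]
  rw [integral_const_mul, integral_comp_two_mul_sqrt hω
    fun x => coshProfile s x - 2 * coshProfile s x ^ 2 + k ^ 2 * coshProfile s x ^ 3,
    integral_add (by exact hint.sub hint2) hint3, integral_sub hint hint2, integral_const_mul,
    integral_const_mul]
  ring

lemma integral_deriv_solitonWave_sq_eq_moments {ω s k : ℝ} (hω : 0 < ω) (hs : 0 < s)
    (hsk : s ^ 2 + k ^ 2 = 1) :
    ∫ z, deriv (solitonWave ω s) z ^ 2 = (1 / 4) * (∫ z, solitonWave ω s z ^ 4)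
      - k ^ 2 / (16 * ω) * ∫ z, solitonWave ω s z ^ 6 := by
  have hr := Real.sqrt_pos.2 hω
  rw [integral_deriv_solitonWave_sq hω hs hsk, integral_solitonWave_pow hω hs 2,
    integral_solitonWave_pow hω hs 3]
  have h3 := integral_coshProfile_cube hs hsk
  field_simp
  linear_combination 16 * h3

lemma integral_solitonWave_four {ω s k : ℝ} (hω : 0 < ω) (hs : 0 < s) (hk : 0 < k)
    (hsk : s ^ 2 + k ^ 2 = 1) :
    ∫ z, solitonWave ω s z ^ 4 =
      8 * ω ^ 2 * (Real.log ((1 + k) / (1 - k)) - 2 * k) / (k ^ 3 * Real.sqrt ω) := by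
  have hr := Real.sqrt_pos.2 hω
  have h2 := integral_coshProfile_sq hs hsk
  rw [integral_coshProfile hs hk hsk] at h2
  rw [integral_solitonWave_pow hω hs 2]
  field_simp at h2 ⊢
  linear_combination (-16) * h2

lemma integral_solitonWave_two {ω s k : ℝ} (hω : 0 < ω) (hs : 0 < s) (hk : 0 < k)
    (hsk : s ^ 2 + k ^ 2 = 1) :
    ∫ z, solitonWave ω s z ^ 2 =
      2 * ω * Real.log ((1 + k) / (1 - k)) / (k * Real.sqrt ω) := by
  have hr := Real.sqrt_pos.2 hω
  have h := integral_solitonWave_pow hω hs 1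
  simp only [mul_one, pow_one] at h
  rw [h, integral_coshProfile hs hk hsk]
  field_simp
  ring

lemma integral_solitonWave_six {ω s k : ℝ} (hω : 0 < ω) (hs : 0 < s) (hk : 0 < k)
    (hsk : s ^ 2 + k ^ 2 = 1) :
    ∫ z, solitonWave ω s z ^ 6 =
      16 * ω ^ 3 * (3 * (Real.log ((1 + k) / (1 - k)) - 2 * k)
        - k ^ 2 * Real.log ((1 + k) / (1 - k))) / (k ^ 5 * Real.sqrt ω) := by
  have hr := Real.sqrt_pos.2 hω
  have h2 := integral_coshProfile_sq hs hsk
  have h3 := integral_coshProfile_cube hs hsk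
  rw [integral_coshProfile hs hk hsk] at h2 h3
  rw [integral_solitonWave_pow hω hs 3]
  field_simp at h2 h3 ⊢
  linear_combination 32 * k ^ 2 * h3 - 96 * h2

/-- A product `P * G` with `G x = 0` has derivative `P x * G'` at `x`. -/
lemma HasDerivAt.mul_of_right_eq_zero {P G : ℝ → ℝ} {G' x : ℝ} (hP : DifferentiableAt ℝ P x)
    (hG : HasDerivAt G G' x) (h0 : G x = 0) : HasDerivAt (fun y => P y * G y) (P x * G') x := by
  exact (hP.hasDerivAt.mul hG).congr_deriv (by simp [h0])

lemma hasDerivAt_log_one_add_div_one_sub {k : ℝ} (hk : 0 < k) (hk1 : k < 1) :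
    HasDerivAt (fun k : ℝ => Real.log ((1 + k) / (1 - k))) (2 / (1 - k ^ 2)) k := by
  have h1 : 0 < 1 - k := by linarith
  have h := (((hasDerivAt_id k).const_add 1).div ((hasDerivAt_id k).const_sub 1) h1.ne').log
    (by simp only [Pi.div_apply, id]; positivity)
  refine h.congr_deriv ?_
  simp only [Pi.div_apply, id]
  rw [show 1 - k ^ 2 = (1 - k) * (1 + k) by ring]
  field_simp
  ring

lemma exists_hasDerivAt_moment_ratio {k : ℝ} (hk : 0 < k) (hk1 : k < 1) :
    ∃ D < 0, HasDerivAt (fun k : ℝ => Real.log ((1 + k) / (1 - k)) /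
      (Real.log ((1 + k) / (1 - k)) - 2 * k)) D k := by
  have hlt := two_mul_lt_log_div hk hk1
  have hgt := log_div_lt hk hk1
  have hL := hasDerivAt_log_one_add_div_one_sub hk hk1
  have hne : Real.log ((1 + k) / (1 - k)) - 2 * k ≠ 0 := by linarith
  have hlin : HasDerivAt (fun k : ℝ => 2 * k) 2 k := by
    simpa using (hasDerivAt_id k).const_mul 2
  refine ⟨(2 / (1 - k ^ 2) * (Real.log ((1 + k) / (1 - k)) - 2 * k) -
    Real.log ((1 + k) / (1 - k)) * (2 / (1 - k ^ 2) - 2)) /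
    (Real.log ((1 + k) / (1 - k)) - 2 * k) ^ 2, ?_, hL.div (hL.sub hlin) hne⟩
  refine div_neg_of_neg_of_pos ?_ (by positivity)
  have h : 2 / (1 - k ^ 2) * k = 2 * k / (1 - k ^ 2) := by ring
  nlinarith

/-- With `Φ`, `d₁*` as in Statement 18 and
`b* = -((dΛ_{d₂}/dω)(ω₀)/(dΛ₂₄/dω)(ω₀))(d₂ - (1/3)αa)`, holding `d₁ = d₁*` fixed:
if `b > b*` then `∂Φ/∂ω(ω₀, d₁*) > 0`, and if `b < b*` then `∂Φ/∂ω(ω₀, d₁*) < 0`. -/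
theorem stmt19 (α a b d2 ω0 : ℝ) (hα : α ≠ 0) (hω0 : 0 < ω0)
    (hβ0 : 0 < -(16 / 3) * α * ω0) (hβ1 : -(16 / 3) * α * ω0 < 1)
    (R0 : ℝ → ℝ → ℝ)
    (hR0 : ∀ ω z : ℝ, R0 ω z =
      Real.sqrt (4 * ω / (1 + Real.sqrt (1 - (-(16 / 3) * α * ω))
        * Real.cosh (2 * Real.sqrt ω * z))))
    (Λ2 Λ4 Λ6 Λ2' Λ24 Λd2 : ℝ → ℝ)
    (hΛ2 : ∀ ω : ℝ, Λ2 ω = ∫ s : ℝ, (R0 ω s) ^ 2)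
    (hΛ4 : ∀ ω : ℝ, Λ4 ω = ∫ s : ℝ, (R0 ω s) ^ 4)
    (hΛ6 : ∀ ω : ℝ, Λ6 ω = ∫ s : ℝ, (R0 ω s) ^ 6)
    (hΛ2' : ∀ ω : ℝ, Λ2' ω = ∫ s : ℝ, (deriv (fun z => R0 ω z) s) ^ 2)
    (hΛ24 : ∀ ω : ℝ, Λ24 ω = Λ2 ω / Λ4 ω)
    (hΛd2 : ∀ ω : ℝ, Λd2 ω = Λ6 ω / Λ4 ω)
    (Φ : ℝ → ℝ → ℝ)
    (hΦ : ∀ ω d1 : ℝ, Φ ω d1 = (1 / (2 * (R0 ω 0) ^ 2)) *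
      (Λ2' ω * a - Λ2 ω * b - Λ4 ω * d1 - Λ6 ω * d2))
    (d1star : ℝ)
    (hd1star : d1star = (1 / 4) * a - Λ24 ω0 * b - Λd2 ω0 * (d2 - (1 / 3) * α * a))
    (bstar : ℝ)
    (hbstar : bstar = -(deriv Λd2 ω0 / deriv Λ24 ω0) * (d2 - (1 / 3) * α * a)) :
    (bstar < b → 0 < deriv (fun ω => Φ ω d1star) ω0) ∧
    (b < bstar → deriv (fun ω => Φ ω d1star) ω0 < 0) := by
  have hev : ∀ᶠ ω in 𝓝 ω0, 0 < ω ∧ 0 < -(16 / 3) * α * ω ∧ -(16 / 3) * α * ω < 1 := by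
    have hc : ContinuousAt (fun ω : ℝ => -(16 / 3) * α * ω) ω0 := by fun_prop
    exact (lt_mem_nhds hω0).and ((hc.eventually (lt_mem_nhds hβ0)).and
      (hc.eventually (gt_mem_nhds hβ1)))
  set κ : ℝ → ℝ := fun ω => Real.sqrt (-(16 / 3) * α * ω) with hκ
  set σ : ℝ → ℝ := fun ω => Real.sqrt (1 - (-(16 / 3) * α * ω)) with hσ
  set L : ℝ → ℝ := fun ω => Real.log ((1 + κ ω) / (1 - κ ω)) with hL
  have hRw : ∀ ω, R0 ω = solitonWave ω (σ ω) := fun ω => funext (hR0 ω)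
  have hbasic : ∀ ω : ℝ, 0 < ω → 0 < -(16 / 3) * α * ω → -(16 / 3) * α * ω < 1 →
      0 < κ ω ∧ κ ω < 1 ∧ 0 < σ ω ∧ κ ω ^ 2 = -(16 / 3) * α * ω ∧ σ ω ^ 2 + κ ω ^ 2 = 1 := by
    intro ω hω h0 h1
    have hk2 : κ ω ^ 2 = -(16 / 3) * α * ω := Real.sq_sqrt h0.le
    have hs2 : σ ω ^ 2 = 1 - (-(16 / 3) * α * ω) := Real.sq_sqrt (by linarith)
    have hk : 0 < κ ω := Real.sqrt_pos.2 h0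
    exact ⟨hk, by nlinarith, Real.sqrt_pos.2 (by linarith), hk2, by linarith⟩
  obtain ⟨hk0, hk1, hs0, hk2, hsk⟩ := hbasic ω0 hω0 hβ0 hβ1
  have hκd : HasDerivAt κ (-(16 / 3) * α / (2 * κ ω0)) ω0 :=
    (((hasDerivAt_id ω0).const_mul (-(16 / 3) * α)).congr_deriv (mul_one _)).sqrt hβ0.ne'
  have hα' : 0 < -(16 / 3) * α := pos_of_mul_pos_left hβ0 hω0.le
  have hσd : DifferentiableAt ℝ σ ω0 :=
    DifferentiableAt.sqrt (by fun_prop) (by linarith)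
  have hLd : DifferentiableAt ℝ L ω0 :=
    ((hasDerivAt_log_one_add_div_one_sub hk0 hk1).comp ω0 hκd).differentiableAt
  have hL0 : L ω0 - 2 * κ ω0 ≠ 0 := (sub_pos.2 (two_mul_lt_log_div hk0 hk1)).ne'
  have hr0 := Real.sqrt_pos.2 hω0
  have hΛ4e : ∀ ω : ℝ, 0 < ω → 0 < -(16 / 3) * α * ω → -(16 / 3) * α * ω < 1 →
      Λ4 ω = 8 * ω ^ 2 * (L ω - 2 * κ ω) / (κ ω ^ 3 * Real.sqrt ω) := by
    intro ω hω h0 h1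
    obtain ⟨hk, -, hs, -, hsk⟩ := hbasic ω hω h0 h1
    rw [hΛ4, hRw, integral_solitonWave_four hω hs hk hsk]
  have hΛ4p : ∀ ω : ℝ, 0 < ω → 0 < -(16 / 3) * α * ω → -(16 / 3) * α * ω < 1 → 0 < Λ4 ω := by
    intro ω hω h0 h1
    obtain ⟨hk, hk1, -⟩ := hbasic ω hω h0 h1
    have := sub_pos.2 (two_mul_lt_log_div hk hk1)
    have hr := Real.sqrt_pos.2 hω
    rw [hΛ4e ω hω h0 h1]
    positivity
  have hΛ24e : Λ24 =ᶠ[𝓝 ω0] fun ω => -(4 / 3 * α) * (L ω / (L ω - 2 * κ ω)) := by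
    filter_upwards [hev] with ω ⟨hω, h0, h1⟩
    obtain ⟨hk, hk1, hs, hk2, hsk⟩ := hbasic ω hω h0 h1
    have hr := Real.sqrt_pos.2 hω
    have hne : L ω - 2 * κ ω ≠ 0 := (sub_pos.2 (two_mul_lt_log_div hk hk1)).ne'
    rw [hΛ24, hΛ4e ω hω h0 h1, hΛ2, hRw, integral_solitonWave_two hω hs hk hsk]
    change 2 * ω * L ω / _ / _ = _
    field_simp
    linear_combination 6 * L ω * hk2
  have hΛd2e : Λd2 =ᶠ[𝓝 ω0] fun ω =>
      2 * ω * (3 * (L ω - 2 * κ ω) - κ ω ^ 2 * L ω) / (κ ω ^ 2 * (L ω - 2 * κ ω)) := by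
    filter_upwards [hev] with ω ⟨hω, h0, h1⟩
    obtain ⟨hk, hk1, hs, hk2, hsk⟩ := hbasic ω hω h0 h1
    have hr := Real.sqrt_pos.2 hω
    have hne : L ω - 2 * κ ω ≠ 0 := (sub_pos.2 (two_mul_lt_log_div hk hk1)).ne'
    rw [hΛd2, hΛ4e ω hω h0 h1, hΛ6, hRw, integral_solitonWave_six hω hs hk hsk]
    change 16 * ω ^ 3 * (3 * (L ω - 2 * κ ω) - κ ω ^ 2 * L ω) / _ / _ = _
    field_simp
    ring
  have hκd' := hκd.differentiableAt
  have hΛd2d : DifferentiableAt ℝ Λd2 ω0 := by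
    refine DifferentiableAt.congr_of_eventuallyEq ?_ hΛd2e
    exact DifferentiableAt.div (by fun_prop) (by fun_prop) (mul_ne_zero (by positivity) hL0)
  obtain ⟨D, hD, hDd⟩ := exists_hasDerivAt_moment_ratio hk0 hk1
  obtain ⟨E, hE, hΛ24d⟩ : ∃ E < 0, HasDerivAt Λ24 E ω0 := by
    refine ⟨_, ?_, ((hDd.comp ω0 hκd).const_mul (-(4 / 3 * α))).congr_of_eventuallyEq hΛ24e⟩
    exact mul_neg_of_pos_of_neg (by linarith) (mul_neg_of_neg_of_pos hD (by positivity))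
  set e : ℝ := d2 - (1 / 3) * α * a with he
  set P : ℝ → ℝ := fun ω => (1 + σ ω) / (8 * ω) *
    (8 * ω ^ 2 * (L ω - 2 * κ ω) / (κ ω ^ 3 * Real.sqrt ω)) with hP
  have hPd : DifferentiableAt ℝ P ω0 := by
    have hsqrt : DifferentiableAt ℝ (fun ω : ℝ => Real.sqrt ω) ω0 :=
      differentiableAt_id.sqrt hω0.ne'
    refine DifferentiableAt.mul ?_ ?_
    · exact DifferentiableAt.div (by fun_prop) (by fun_prop) (by positivity)
    · exact DifferentiableAt.div (by fun_prop) (by fun_prop) (by positivity)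
  have hP0 : 0 < P ω0 := by
    have := sub_pos.2 (two_mul_lt_log_div hk0 hk1)
    change 0 < (1 + σ ω0) / (8 * ω0) *
      (8 * ω0 ^ 2 * (L ω0 - 2 * κ ω0) / (κ ω0 ^ 3 * Real.sqrt ω0))
    positivity
  have hΦe : (fun ω => Φ ω d1star) =ᶠ[𝓝 ω0]
      fun ω => P ω * ((1 / 4) * a - Λ24 ω * b - Λd2 ω * e - d1star) := by
    filter_upwards [hev] with ω ⟨hω, h0, h1⟩
    obtain ⟨hk, hk1, hs, hk2, hsk⟩ := hbasic ω hω h0 h1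
    have h4 := (hΛ4p ω hω h0 h1).ne'
    have hPω : P ω = (1 + σ ω) / (8 * ω) * Λ4 ω := by rw [hΛ4e ω hω h0 h1]
    have hR : R0 ω 0 ^ 2 = 4 * ω / (1 + σ ω) := by
      rw [hRw, solitonWave_sq hω hs]
      simp [coshProfile, div_eq_mul_inv]
    have hm : Λ2' ω = (1 / 4) * Λ4 ω + (1 / 3) * α * Λ6 ω := by
      have h := integral_deriv_solitonWave_sq_eq_moments hω hs hsk
      have hc : κ ω ^ 2 / (16 * ω) = -((1 / 3) * α) := by rw [hk2]; field_simp
      rw [hΛ2', hΛ4, hΛ6, hRw]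
      rw [hc] at h
      linear_combination h
    rw [hΦ, hm, hPω, hR, hΛ24, hΛd2, he]
    field_simp
    ring
  have hΛd2' := hΛd2d.hasDerivAt
  have hG : HasDerivAt (fun ω => (1 / 4) * a - Λ24 ω * b - Λd2 ω * e - d1star)
      (-(E * b) - deriv Λd2 ω0 * e) ω0 := by
    refine ((((hΛ24d.mul_const b).const_sub ((1 / 4) * a)).sub
      (hΛd2'.mul_const e)).sub_const d1star).congr_deriv rfl
  have hfin := ((HasDerivAt.mul_of_right_eq_zero hPd hG
    (by rw [hd1star]; ring)).congr_of_eventuallyEq hΦe).deriv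
  have hb : -(E * b) - deriv Λd2 ω0 * e = -E * (b - bstar) := by
    rw [hbstar, hΛ24d.deriv]
    have := hE.ne
    field_simp
    ring
  rw [hfin, hb]
  exact ⟨fun h => mul_pos hP0 (mul_pos (by linarith) (by linarith)),
    fun h => mul_neg_of_pos_of_neg hP0 (mul_neg_of_pos_of_neg (by linarith) (by linarith))⟩
end
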